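/- Let f : [0,T] × H → H be continuous and K-Lipschitz in its second variable, let (φ̃, g̃) ∈ H × H and ε > 0. Then there exists a unique continuous function v : [0,T] → H solving the regularized integral equation with source f, data (φ̃, g̃) and parameter ε. -/

import Mathlib

open scoped RealInnerProductSpace

/-- `Q(ε,λ) = e^{−√λ·T}/(ε + e^{−√λ·T})`. -/
noncomputable def regQ (T ε lam : ℝ) : ℝ :=
  Real.exp (-(Real.sqrt lam * T)) / (ε + Real.exp (-(Real.sqrt lam * T)))

/-- `coshᵉ(√λ·t) = (Q(ε,λ)e^{√λ·t} + e^{−√λ·t})/2`. -/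
noncomputable def coshE (T ε lam t : ℝ) : ℝ :=
  (regQ T ε lam * Real.exp (Real.sqrt lam * t) + Real.exp (-(Real.sqrt lam * t))) / 2

/-- `sinhᵉ(√λ·t) = (Q(ε,λ)e^{√λ·t} − e^{−√λ·t})/2`. -/
noncomputable def sinhE (T ε lam t : ℝ) : ℝ :=
  (regQ T ε lam * Real.exp (Real.sqrt lam * t) - Real.exp (-(Real.sqrt lam * t))) / 2

variable {H : Type*} [NormedAddCommGroup H] [InnerProductSpace ℝ H]

/-- `F` is `K`-Lipschitz in its second variable on `[0,T] × H`. -/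
def LipschitzInSecond (T K : ℝ) (F : ℝ → H → H) : Prop :=
  ∀ t ∈ Set.Icc (0 : ℝ) T, ∀ w v : H, ‖F t w - F t v‖ ≤ K * ‖w - v‖

/-- `v` solves the regularized integral equation with source `F`, data `(φt, gt)`
and parameter `ε`. -/
def SolvesReg (T ε : ℝ) (lam : ℕ → ℝ) (b : HilbertBasis ℕ ℝ H)
    (F : ℝ → H → H) (φt gt : H) (v : ℝ → H) : Prop :=
  ∀ t ∈ Set.Icc (0 : ℝ) T,
    v t = ∑' p : ℕ, (coshE T ε (lam p) t * ⟪φt, b p⟫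
      + sinhE T ε (lam p) t / Real.sqrt (lam p) * ⟪gt, b p⟫
      + ∫ s in (0 : ℝ)..t,
          sinhE T ε (lam p) (t - s) / Real.sqrt (lam p) * ⟪F s (v s), b p⟫) • (b p : H)

/-- `u` solves the mild integral equation with source `F` and data `(φ, g)`. -/
def SolvesMild (T : ℝ) (lam : ℕ → ℝ) (b : HilbertBasis ℕ ℝ H)
    (F : ℝ → H → H) (φ g : H) (u : ℝ → H) : Prop :=
  ∀ t ∈ Set.Icc (0 : ℝ) T,
    u t = ∑' p : ℕ, (Real.cosh (Real.sqrt (lam p) * t) * ⟪φ, b p⟫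
      + Real.sinh (Real.sqrt (lam p) * t) / Real.sqrt (lam p) * ⟪g, b p⟫
      + ∫ s in (0 : ℝ)..t,
          Real.sinh (Real.sqrt (lam p) * (t - s)) / Real.sqrt (lam p)
            * ⟪F s (u s), b p⟫) • (b p : H)

/-- The pair `(u, w)` satisfies the exponential coefficient identity with source `F`
and data `(φ, g)`. -/
def ExpCoeffId (T : ℝ) (lam : ℕ → ℝ) (b : HilbertBasis ℕ ℝ H)
    (F : ℝ → H → H) (φ g : H) (u w : ℝ → H) : Prop :=
  ∀ p : ℕ, ∀ t ∈ Set.Icc (0 : ℝ) T,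
    ⟪u t, b p⟫ + ⟪w t, b p⟫ / Real.sqrt (lam p)
      = Real.exp (Real.sqrt (lam p) * t)
          * (⟪φ, b p⟫ + ⟪g, b p⟫ / Real.sqrt (lam p))
        + ∫ s in (0 : ℝ)..t,
            Real.exp (Real.sqrt (lam p) * (t - s)) / Real.sqrt (lam p)
              * ⟪F s (u s), b p⟫

/-- The pair `(u, w)` satisfies the a priori bound with constant `P`. -/
def APrioriBound (T : ℝ) (lam : ℕ → ℝ) (b : HilbertBasis ℕ ℝ H)
    (u w : ℝ → H) (P : ℝ) : Prop :=
  ∀ t ∈ Set.Icc (0 : ℝ) T,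
    ∑' p : ℕ, Real.exp (2 * Real.sqrt (lam p) * (T - t))
      * (⟪u t, b p⟫ + ⟪w t, b p⟫ / Real.sqrt (lam p)) ^ 2 ≤ P ^ 2


/-- Diagonal operators. -/
theorem diag_exists {H : Type*} [NormedAddCommGroup H] [InnerProductSpace ℝ H] [CompleteSpace H]
    (b : HilbertBasis ℕ ℝ H) (m : ℕ → ℝ) (M : ℝ) (hM : ∀ p, |m p| ≤ M) :
    ∃ S : H →L[ℝ] H, (∀ x, ‖S x‖ ≤ M * ‖x‖) ∧ ∀ x p, ⟪b p, S x⟫ = m p * ⟪b p, x⟫ := by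
  have hM0 : 0 ≤ M := (abs_nonneg _).trans (hM 0)
  have hsum : ∀ x : H, ∀ s : Finset ℕ, ∑ p ∈ s, ‖m p * b.repr x p‖ ^ (2:ENNReal).toReal
      ≤ (M * ‖x‖) ^ (2:ENNReal).toReal := by
    intro x s
    have h1 := lp.sum_rpow_le_norm_rpow (p := 2) (by norm_num) (b.repr x) s
    rw [b.repr.norm_map] at h1
    rw [Real.mul_rpow hM0 (norm_nonneg _)]
    refine le_trans ?_ (mul_le_mul_of_nonneg_left h1 (by positivity))
    rw [Finset.mul_sum]
    refine Finset.sum_le_sum fun p _ => ?_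
    rw [norm_mul, Real.mul_rpow (norm_nonneg _) (norm_nonneg _)]
    gcongr
    exact hM p
  have hmem : ∀ x : H, Memℓp (fun p => m p * b.repr x p) 2 := fun x =>
    memℓp_gen' (hsum x)
  let S0 : H →ₗ[ℝ] H :=
    { toFun := fun x => b.repr.symm ⟨fun p => m p * b.repr x p, hmem x⟩
      map_add' := by
        intro x y
        rw [← map_add]
        congr 1
        ext p
        simp [mul_add]
        rfl
      map_smul' := by
        intro c x
        rw [RingHom.id_apply, ← map_smul]
        congr 1
        ext p
        simp [mul_left_comm] }
  have hb : ∀ x, ‖S0 x‖ ≤ M * ‖x‖ := by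
    intro x
    change ‖b.repr.symm _‖ ≤ _
    rw [LinearIsometryEquiv.norm_map]
    exact lp.norm_le_of_forall_sum_le (by norm_num) (by positivity) (hsum x)
  refine ⟨S0.mkContinuous M hb, hb, ?_⟩
  intro x p
  change ⟪b p, b.repr.symm _⟫ = _
  rw [← b.repr_apply_apply, ← b.repr_apply_apply, LinearIsometryEquiv.apply_symm_apply]

/-- Strongly continuous families of diagonal operators. -/
theorem diag_family {H : Type*} [NormedAddCommGroup H] [InnerProductSpace ℝ H] [CompleteSpace H]
    (b : HilbertBasis ℕ ℝ H) (m : ℕ → ℝ → ℝ) (M : ℝ) (hM : ∀ p t, |m p t| ≤ M)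
    (hc : ∀ p, Continuous (m p)) :
    ∃ S : ℝ → H →L[ℝ] H, (∀ t x, ‖S t x‖ ≤ M * ‖x‖) ∧
      (∀ t x p, ⟪b p, S t x⟫ = m p t * ⟪b p, x⟫) ∧
      Continuous (fun q : ℝ × H => S q.1 q.2) := by
  choose S hS hSp using fun t => diag_exists b (fun p => m p t) M (fun p => hM p t)
  have hM0 : 0 ≤ M := (abs_nonneg _).trans (hM 0 0)
  refine ⟨S, hS, hSp, ?_⟩
  have hbp : ∀ t p, S t (b p) = m p t • b p := by
    intro t p
    apply b.repr.injective
    ext q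
    rw [b.repr_apply_apply, b.repr_apply_apply, hSp, inner_smul_right]
    have := orthonormal_iff_ite.mp b.orthonormal q p
    rw [this]
    by_cases h : q = p <;> simp [h]
  have key : ∀ x, Continuous fun t => S t x := by
    intro x
    have hx : x ∈ closure ((Submodule.span ℝ (Set.range b) : Submodule ℝ H) : Set H) := by
      have := b.dense_span
      rw [← Submodule.topologicalClosure_coe, this]
      trivial
    rw [Metric.mem_closure_iff] at hx
    have hspan : ∀ y ∈ Submodule.span ℝ (Set.range b), Continuous fun t => S t y := by
      intro y hy
      induction hy using Submodule.span_induction with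
      | mem y h =>
        obtain ⟨p, rfl⟩ := h
        simp only [hbp]
        exact (hc p).smul continuous_const
      | zero => simpa using continuous_const
      | add y z _ _ hy hz => simp only [map_add]; exact hy.add hz
      | smul c y _ hy => simp only [map_smul]; exact hy.const_smul c
    refine continuous_of_uniform_approx_of_continuous ?_
    intro u hu
    obtain ⟨e, he, heu⟩ := Metric.mem_uniformity_dist.mp hu
    obtain ⟨y, hy, hxy⟩ := hx (e / (M + 1)) (by positivity)
    refine ⟨fun t => S t y, hspan y hy, fun t => heu ?_⟩
    rw [dist_eq_norm, ← map_sub]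
    refine (hS t _).trans_lt ?_
    rw [dist_eq_norm, lt_div_iff₀ (by positivity)] at hxy
    nlinarith [norm_nonneg (x - y)]
  have := continuous_prod_of_continuous_lipschitzWith' (fun q : ℝ × H => S q.1 q.2) M.toNNReal
    (fun t => LipschitzWith.of_dist_le_mul fun x y => by
      rw [dist_eq_norm, dist_eq_norm, ← map_sub, Real.coe_toNNReal _ hM0]
      exact hS t _) key
  exact this

theorem integral_exp_mul_real_aux {L t : ℝ} (hL : L ≠ 0) :
    ∫ s in (0:ℝ)..t, Real.exp (L * s) = (Real.exp (L * t) - 1) / L := by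
  rw [intervalIntegral.integral_comp_mul_left (fun x => Real.exp x) hL, integral_exp]
  simp [div_eq_inv_mul]

/-- Volterra equations. -/
theorem volterra {H : Type*} [NormedAddCommGroup H] [InnerProductSpace ℝ H] [CompleteSpace H]
    (T M K : ℝ) (hT : 0 < T) (hM : 0 ≤ M) (hK : 0 ≤ K) (h : ℝ → H) (hh : Continuous h)
    (S : ℝ → H →L[ℝ] H) (hS : ∀ t x, ‖S t x‖ ≤ M * ‖x‖)
    (hSc : Continuous (fun q : ℝ × H => S q.1 q.2))
    (F : ℝ → H → H) (hF : Continuous (fun q : ℝ × H => F q.1 q.2))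
    (hFL : ∀ t x y, ‖F t x - F t y‖ ≤ K * ‖x - y‖) :
    (∃ v : ℝ → H, Continuous v ∧ ∀ t ∈ Set.Icc 0 T,
      v t = h t + ∫ s in (0:ℝ)..t, S (t - s) (F s (v s))) ∧
    (∀ v v' : ℝ → H, Continuous v → Continuous v' →
      (∀ t ∈ Set.Icc 0 T, v t = h t + ∫ s in (0:ℝ)..t, S (t - s) (F s (v s))) →
      (∀ t ∈ Set.Icc 0 T, v' t = h t + ∫ s in (0:ℝ)..t, S (t - s) (F s (v' s))) →
      Set.EqOn v v' (Set.Icc 0 T)) := by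
  set L : ℝ := 2 * (M * K) + 1 with hL
  have hMK : 0 ≤ M * K := mul_nonneg hM hK
  have hLpos : 0 < L := by positivity
  have hT0 := hT.le
  let E : C(Set.Icc (0:ℝ) T, H) → ℝ → H := fun w => Set.IccExtend hT0 w
  have hE : ∀ w, Continuous (E w) := fun w => w.continuous.Icc_extend'
  have hint : ∀ w : ℝ → H, Continuous w →
      Continuous (fun q : ℝ × ℝ => S (q.1 - q.2) (F q.2 (w q.2))) := fun w hw =>
    hSc.comp ((continuous_fst.sub continuous_snd).prodMk
      (hF.comp (continuous_snd.prodMk (hw.comp continuous_snd))))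
  have hint1 : ∀ w : ℝ → H, Continuous w → ∀ t : ℝ,
      Continuous (fun s : ℝ => S (t - s) (F s (w s))) := fun w hw t =>
    (hint w hw).comp (continuous_const.prodMk continuous_id)
  have hW : ∀ w, Continuous (fun s => Real.exp (L * s) • E w s) := fun w =>
    (by fun_prop : Continuous fun s => Real.exp (L * s)).smul (hE w)
  let G : C(Set.Icc (0:ℝ) T, H) → C(Set.Icc (0:ℝ) T, H) := fun w =>
    ⟨fun t => Real.exp (-(L * t)) • (h t + ∫ s in (0:ℝ)..t,
        S (t - s) (F s (Real.exp (L * s) • E w s))), by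
      have h1 := intervalIntegral.continuous_parametric_intervalIntegral_of_continuous
        (μ := MeasureTheory.volume) (a₀ := 0)
        (f := fun t s => S (t - s) (F s (Real.exp (L * s) • E w s)))
        (s := fun t => t) (hint _ (hW w)) continuous_id
      have h2 : Continuous fun t : ℝ => Real.exp (-(L * t)) • (h t + ∫ s in (0:ℝ)..t,
        S (t - s) (F s (Real.exp (L * s) • E w s))) :=
        (by fun_prop : Continuous fun t : ℝ => Real.exp (-(L * t))).smul (hh.add h1)
      exact h2.comp continuous_subtype_val⟩
  have hG : ∀ w t, G w t = Real.exp (-(L * t)) • (h t + ∫ s in (0:ℝ)..t,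
        S (t - s) (F s (Real.exp (L * s) • E w s))) := fun _ _ => rfl
  have hexp : ∀ t, Real.exp (-(L * t)) * Real.exp (L * t) = 1 := fun t => by
    rw [← Real.exp_add]; simp
  have hEd : ∀ w w' s, ‖E w s - E w' s‖ ≤ dist w w' := fun w w' s => by
    rw [← dist_eq_norm]; exact ContinuousMap.dist_apply_le_dist _
  have hcon : ContractingWith (1/2 : NNReal) G := by
    refine ⟨by rw [← NNReal.coe_lt_coe]; norm_num, LipschitzWith.of_dist_le_mul fun w w' => ?_⟩
    rw [ContinuousMap.dist_le (by positivity)]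
    intro t
    obtain ⟨t, ht0, htT⟩ := t
    rw [dist_eq_norm, hG, hG, ← smul_sub, add_sub_add_left_eq_sub,
      ← intervalIntegral.integral_sub ((hint1 _ (hW w) t).intervalIntegrable _ _)
        ((hint1 _ (hW w') t).intervalIntegrable _ _), norm_smul, Real.norm_eq_abs, Real.abs_exp]
    have hb : ‖∫ s in (0:ℝ)..t, (S (t - s) (F s (Real.exp (L * s) • E w s))
        - S (t - s) (F s (Real.exp (L * s) • E w' s)))‖
        ≤ ∫ s in (0:ℝ)..t, (M * K * dist w w') * Real.exp (L * s) := by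
      refine intervalIntegral.norm_integral_le_of_norm_le ht0 (Filter.Eventually.of_forall ?_)
        (Continuous.intervalIntegrable (by fun_prop) _ _)
      intro s _
      rw [← map_sub]
      refine (hS _ _).trans ?_
      have h1 := hFL s (Real.exp (L * s) • E w s) (Real.exp (L * s) • E w' s)
      rw [← smul_sub, norm_smul, Real.norm_eq_abs, Real.abs_exp] at h1
      calc _ ≤ M * (K * (Real.exp (L * s) * dist w w')) := by
            refine mul_le_mul_of_nonneg_left (h1.trans ?_) hM
            gcongr
            exact hEd w w' s
        _ = _ := by ring
    rw [intervalIntegral.integral_const_mul, integral_exp_mul_real_aux hLpos.ne'] at hb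
    have h3 := mul_le_mul_of_nonneg_left hb (Real.exp_pos (-(L * t))).le
    refine h3.trans ?_
    have h4 : Real.exp (-(L * t)) * (M * K * dist w w' * ((Real.exp (L * t) - 1) / L))
        = (M * K / L) * dist w w' * (1 - Real.exp (-(L * t))) := by
      have := hexp t
      field_simp
      linear_combination (M * K * dist w w') * this
    rw [h4]
    have h5 : M * K / L ≤ 1 / 2 := by
      rw [div_le_iff₀ hLpos]; linarith
    have h6 : 0 ≤ M * K / L := by positivity
    have h7 : (1 - Real.exp (-(L * t))) ≤ 1 := by linarith [Real.exp_pos (-(L * t))]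
    calc _ ≤ (M * K / L) * dist w w' * 1 := by gcongr
      _ ≤ _ := by
        rw [mul_one]; push_cast; gcongr
  have : Nonempty C(Set.Icc (0:ℝ) T, H) := ⟨0⟩
  constructor
  · set w := ContractingWith.fixedPoint G hcon
    have hw : G w = w := ContractingWith.fixedPoint_isFixedPt hcon
    refine ⟨fun s => Real.exp (L * s) • E w s, hW w, fun t ht => ?_⟩
    have h1 : E w t = w ⟨t, ht⟩ := Set.IccExtend_of_mem hT0 _ ht
    simp only [h1]
    nth_rewrite 1 [← hw]
    rw [hG, smul_smul, mul_comm, hexp, one_smul]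
  · intro v v' hv hv' hve hve'
    have fp : ∀ v : ℝ → H, ∀ hv : Continuous v,
        (∀ t ∈ Set.Icc 0 T, v t = h t + ∫ s in (0:ℝ)..t, S (t - s) (F s (v s))) →
        Function.IsFixedPt G ⟨fun t => Real.exp (-(L * (t:ℝ))) • v t,
          (by fun_prop : Continuous fun t : Set.Icc (0:ℝ) T => Real.exp (-(L * (t:ℝ)))).smul
            (hv.comp continuous_subtype_val)⟩ := by
      intro v hv hve
      ext t
      obtain ⟨t, ht⟩ := t
      rw [hG]
      change _ = Real.exp (-(L * t)) • v t
      rw [hve t ht]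
      congr 2
      refine intervalIntegral.integral_congr fun s hs => ?_
      rw [Set.uIcc_of_le ht.1] at hs
      have hsT : s ∈ Set.Icc 0 T := ⟨hs.1, hs.2.trans ht.2⟩
      dsimp only [E]
      rw [Set.IccExtend_of_mem hT0 _ hsT]
      simp only [ContinuousMap.coe_mk]
      rw [smul_smul, mul_comm, hexp, one_smul]
    have heq := hcon.fixedPoint_unique' (fp v hv hve) (fp v' hv' hve')
    intro t ht
    have h1 := DFunLike.congr_fun heq ⟨t, ht⟩
    simp only [ContinuousMap.coe_mk] at h1
    exact smul_right_injective H (Real.exp_pos _).ne' h1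

theorem regQ_mul_exp_le (T ε lam t : ℝ) (hε : 0 < ε) (ht : t ≤ T) :
    0 ≤ regQ T ε lam * Real.exp (Real.sqrt lam * t) ∧
    regQ T ε lam * Real.exp (Real.sqrt lam * t) ≤ 1 / ε := by
  unfold regQ
  refine ⟨by positivity, ?_⟩
  rw [div_mul_eq_mul_div, ← Real.exp_add]
  have h1 : Real.exp (-(Real.sqrt lam * T) + Real.sqrt lam * t) ≤ 1 := by
    rw [Real.exp_le_one_iff]
    nlinarith [Real.sqrt_nonneg lam]
  have h2 := Real.exp_pos (-(Real.sqrt lam * T))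
  gcongr
  linarith

theorem exp_neg_bd (lam t : ℝ) (ht : 0 ≤ t) :
    0 ≤ Real.exp (-(Real.sqrt lam * t)) ∧ Real.exp (-(Real.sqrt lam * t)) ≤ 1 := by
  refine ⟨by positivity, ?_⟩
  rw [Real.exp_le_one_iff]
  nlinarith [Real.sqrt_nonneg lam, mul_nonneg (Real.sqrt_nonneg lam) ht]

theorem coshE_bd (T ε lam t : ℝ) (hε : 0 < ε) (ht : t ∈ Set.Icc 0 T) :
    |coshE T ε lam t| ≤ 1 / ε + 1 := by
  obtain ⟨h1, h2⟩ := regQ_mul_exp_le T ε lam t hε ht.2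
  obtain ⟨h3, h4⟩ := exp_neg_bd lam t ht.1
  unfold coshE
  rw [abs_le]
  constructor <;> linarith

theorem sinhE_bd (T ε lam t : ℝ) (hε : 0 < ε) (ht : t ∈ Set.Icc 0 T) :
    |sinhE T ε lam t| ≤ 1 / ε + 1 := by
  obtain ⟨h1, h2⟩ := regQ_mul_exp_le T ε lam t hε ht.2
  obtain ⟨h3, h4⟩ := exp_neg_bd lam t ht.1
  unfold sinhE
  rw [abs_le]
  constructor <;> linarith

theorem stmt_2 {H : Type*} [NormedAddCommGroup H] [InnerProductSpace ℝ H] [CompleteSpace H]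
    (T K ε : ℝ) (hT : 0 < T) (hε : 0 < ε)
    (lam : ℕ → ℝ) (lam1 : ℝ) (hlam1 : 0 < lam1) (hlam : ∀ p, lam1 ≤ lam p)
    (b : HilbertBasis ℕ ℝ H) (f : ℝ → H → H)
    (hfc : ContinuousOn (Function.uncurry f) (Set.Icc (0 : ℝ) T ×ˢ (Set.univ : Set H)))
    (hfL : LipschitzInSecond T K f) (φt gt : H) :
    (∃ v : ℝ → H, ContinuousOn v (Set.Icc 0 T) ∧ SolvesReg T ε lam b f φt gt v) ∧
    (∀ v v' : ℝ → H, ContinuousOn v (Set.Icc 0 T) → SolvesReg T ε lam b f φt gt v →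
      ContinuousOn v' (Set.Icc 0 T) → SolvesReg T ε lam b f φt gt v' →
      Set.EqOn v v' (Set.Icc 0 T)) := by
  classical
  have hT0 := hT.le
  let π : ℝ → ℝ := fun t => Set.projIcc 0 T hT0 t
  have hπc : Continuous π := continuous_subtype_val.comp continuous_projIcc
  have hπm : ∀ t, π t ∈ Set.Icc 0 T := fun t => (Set.projIcc 0 T hT0 t).2
  have hπe : ∀ t ∈ Set.Icc 0 T, π t = t := fun t ht => by
    simp only [π, Set.projIcc_of_mem hT0 ht]
  have hsq : 0 < Real.sqrt lam1 := Real.sqrt_pos.mpr hlam1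
  have hsqp : ∀ p, Real.sqrt lam1 ≤ Real.sqrt (lam p) := fun p => Real.sqrt_le_sqrt (hlam p)
  obtain ⟨A, hA, hAp, hAc⟩ := diag_family b (fun p t => coshE T ε (lam p) (π t)) (1 / ε + 1)
    (fun p t => coshE_bd T ε _ _ hε (hπm t)) (fun p => by unfold coshE; fun_prop)
  obtain ⟨S, hS, hSp, hSc⟩ := diag_family b
    (fun p t => sinhE T ε (lam p) (π t) / Real.sqrt (lam p)) ((1 / ε + 1) / Real.sqrt lam1)
    (fun p t => by
      rw [abs_div, abs_of_nonneg (Real.sqrt_nonneg _)]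
      have := sinhE_bd T ε (lam p) _ hε (hπm t)
      have := hsqp p
      gcongr)
    (fun p => by unfold sinhE; fun_prop)
  let F : ℝ → H → H := fun t x => f (π t) x
  have hF : Continuous (fun q : ℝ × H => F q.1 q.2) :=
    hfc.comp_continuous ((hπc.comp continuous_fst).prodMk continuous_snd)
      (fun q => ⟨hπm _, trivial⟩)
  let h : ℝ → H := fun t => A t φt + S t gt
  have hh : Continuous h := (hAc.comp (continuous_id.prodMk continuous_const)).add
    (hSc.comp (continuous_id.prodMk continuous_const))
  obtain ⟨⟨w, hwc, hw⟩, huniq⟩ := volterra T ((1 / ε + 1) / Real.sqrt lam1) |K| hT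
    (by positivity) (abs_nonneg K) h hh S hS hSc F hF
    (fun t x y => (hfL _ (hπm t) x y).trans (by gcongr; exact le_abs_self K))
  have bridge : ∀ v u : ℝ → H, Continuous u → Set.EqOn v u (Set.Icc 0 T) →
      ∀ t ∈ Set.Icc (0:ℝ) T,
      ∑' p : ℕ, (coshE T ε (lam p) t * ⟪φt, b p⟫
      + sinhE T ε (lam p) t / Real.sqrt (lam p) * ⟪gt, b p⟫
      + ∫ s in (0 : ℝ)..t,
          sinhE T ε (lam p) (t - s) / Real.sqrt (lam p) * ⟪f s (v s), b p⟫) • (b p : H)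
      = h t + ∫ s in (0:ℝ)..t, S (t - s) (F s (u s)) := by
    intro v u hu hvu t ht
    have hci : Continuous (fun s : ℝ => S (t - s) (F s (u s))) :=
      hSc.comp ((continuous_const.sub continuous_id).prodMk
        (hF.comp (continuous_id.prodMk hu)))
    rw [← (b.hasSum_repr (h t + ∫ s in (0:ℝ)..t, S (t - s) (F s (u s)))).tsum_eq]
    refine tsum_congr fun p => ?_
    congr 1
    rw [b.repr_apply_apply, inner_add_right, inner_add_right, hAp, hSp, hπe t ht,
      real_inner_comm φt, real_inner_comm gt]
    congr 1
    have h1 := (innerSL ℝ (b p)).intervalIntegral_comp_comm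
      (hci.intervalIntegrable (μ := MeasureTheory.volume) 0 t)
    simp only [innerSL_apply_apply] at h1
    rw [← h1]
    refine intervalIntegral.integral_congr fun s hs => ?_
    rw [Set.uIcc_of_le ht.1] at hs
    have hsT : s ∈ Set.Icc 0 T := ⟨hs.1, hs.2.trans ht.2⟩
    have htsT : t - s ∈ Set.Icc 0 T := ⟨by linarith [hs.2], by linarith [hs.1, ht.2]⟩
    simp only [F]
    rw [hSp, hπe _ htsT, hπe _ hsT, hvu hsT, real_inner_comm]
  refine ⟨⟨w, hwc.continuousOn, fun t ht => ?_⟩, ?_⟩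
  · rw [bridge w w hwc (fun _ _ => rfl) t ht]
    exact hw t ht
  · intro v v' hv hvs hv' hvs'
    have hc : ∀ v : ℝ → H, ContinuousOn v (Set.Icc 0 T) → Continuous (v ∘ π) := fun v hv =>
      hv.comp_continuous hπc hπm
    have he : ∀ v : ℝ → H, Set.EqOn v (v ∘ π) (Set.Icc 0 T) := fun v t ht => by
      simp [hπe t ht]
    have hs : ∀ v : ℝ → H, ContinuousOn v (Set.Icc 0 T) → SolvesReg T ε lam b f φt gt v →
        ∀ t ∈ Set.Icc 0 T, (v ∘ π) t = h t + ∫ s in (0:ℝ)..t, S (t - s) (F s ((v ∘ π) s)) := by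
      intro v hv hvs t ht
      rw [← bridge v (v ∘ π) (hc v hv) (he v) t ht, ← he v ht]
      exact hvs t ht
    have := huniq _ _ (hc v hv) (hc v' hv') (hs v hv hvs) (hs v' hv' hvs')
    exact fun t ht => ((he v ht).trans (this ht)).trans (he v' ht).symm
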